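/- Let c > 0. For the urn process (U_k) with parameters n and p = c/n, the variance of T_k = U_k/(√n (1−c/n)^k) − √n satisfies: there exists a constant C > 0 (depending only on c) such that for all integers n > 2c and all 0 ≤ k ≤ n, |Var(T_k) − (e^{ck/n} − 1)| ≤ C/n. -/

import Mathlib

open MeasureTheory ProbabilityTheory Filter

/-- The probability that a Binomial(N, p) random variable takes the value `j`. -/
noncomputable def binomialProb (N : ℕ) (p : ℝ) (j : ℕ) : ℝ :=
  (N.choose j : ℝ) * p ^ j * (1 - p) ^ (N - j)

/-- `U` is an urn process with parameters `n` and `p`: it starts at `n`, is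
(pointwise a.s.) nonincreasing, and conditionally on `U 0, …, U k` the decrement
`U k - U (k+1)` has a Binomial(`U k`, `p`) distribution. -/
def IsUrnProcess {Ω : Type*} [MeasurableSpace Ω] (μ : Measure Ω)
    (n : ℕ) (p : ℝ) (U : ℕ → Ω → ℕ)
    (hU : ∀ i, StronglyMeasurable (U i)) : Prop :=
  (∀ᵐ ω ∂μ, U 0 ω = n) ∧
  (∀ k, ∀ᵐ ω ∂μ, U (k + 1) ω ≤ U k ω) ∧
  (∀ k j, μ[Set.indicator {ω | U k ω - U (k + 1) ω = j} (fun _ => (1 : ℝ)) |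
      MeasureTheory.Filtration.natural U hU k]
    =ᵐ[μ] fun ω => binomialProb (U k ω) p j)

lemma sum_binomialProb_reflect (N : ℕ) (p : ℝ) (f : ℕ → ℝ) :
    ∑ j ∈ Finset.range (N + 1), f (N - j) * binomialProb N p j
      = ∑ j ∈ Finset.range (N + 1), f j * (bernsteinPolynomial ℝ N j).eval (1 - p) := by
  rw [← Finset.sum_range_reflect]
  refine Finset.sum_congr rfl fun j hj => ?_
  have hjN : j ≤ N := Nat.lt_succ_iff.mp (Finset.mem_range.mp hj)
  have h1 : N + 1 - 1 - j = N - j := by omega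
  rw [h1, Nat.sub_sub_self hjN, binomialProb, Nat.choose_symm hjN, Nat.sub_sub_self hjN]
  simp only [bernsteinPolynomial, Polynomial.eval_mul, Polynomial.eval_pow, Polynomial.eval_X,
    Polynomial.eval_sub, Polynomial.eval_one, Polynomial.eval_natCast, sub_sub_cancel]
  ring

lemma sum_sub_mul_binomialProb (N : ℕ) (p : ℝ) :
    ∑ j ∈ Finset.range (N + 1), ((N - j : ℕ) : ℝ) * binomialProb N p j = N * (1 - p) := by
  rw [sum_binomialProb_reflect N p fun i => (i : ℝ)]
  have h := congrArg (Polynomial.eval (1 - p)) (bernsteinPolynomial.sum_smul ℝ N)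
  simpa [Polynomial.eval_finsetSum] using h

lemma natCast_mul_natPred (i : ℕ) : ((i * (i - 1) : ℕ) : ℝ) = i * ((i : ℝ) - 1) := by
  cases i <;> simp

lemma sum_sub_mul_pred_mul_binomialProb (N : ℕ) (p : ℝ) :
    ∑ j ∈ Finset.range (N + 1),
        (((N - j : ℕ) : ℝ) * (((N - j : ℕ) : ℝ) - 1)) * binomialProb N p j
      = N * ((N : ℝ) - 1) * (1 - p) ^ 2 := by
  rw [sum_binomialProb_reflect N p fun i => (i : ℝ) * ((i : ℝ) - 1)]
  have h := congrArg (Polynomial.eval (1 - p)) (bernsteinPolynomial.sum_mul_smul ℝ N)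
  simp only [Polynomial.eval_finsetSum, nsmul_eq_mul, Polynomial.eval_mul,
    Polynomial.eval_natCast, Polynomial.eval_pow, Polynomial.eval_X, natCast_mul_natPred] at h
  exact h

lemma binomialProb_eq_zero_of_lt {N j : ℕ} (p : ℝ) (h : N < j) : binomialProb N p j = 0 := by
  simp [binomialProb, Nat.choose_eq_zero_of_lt h]

lemma sum_range_mul_binomialProb {N n : ℕ} (hN : N ≤ n) (p : ℝ) (f : ℕ → ℝ) :
    ∑ j ∈ Finset.range (n + 1), f j * binomialProb N p j
      = ∑ j ∈ Finset.range (N + 1), f j * binomialProb N p j := by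
  refine (Finset.sum_subset (Finset.range_mono (by omega)) fun j _ hj => ?_).symm
  rw [binomialProb_eq_zero_of_lt p (by simpa using hj), mul_zero]

section Urn

variable {Ω : Type*} [MeasurableSpace Ω] {μ : Measure Ω}

lemma memLp_comp_of_ae_le [IsFiniteMeasure μ] {V : Ω → ℕ} (hV : Measurable V) {n : ℕ}
    (hn : ∀ᵐ ω ∂μ, V ω ≤ n) (g : ℕ → ℝ) (q : ENNReal) : MemLp (fun ω => g (V ω)) q μ := by
  refine MemLp.of_bound ((measurable_of_countable g).comp hV).aestronglyMeasurable
    (∑ i ∈ Finset.range (n + 1), |g i|) ?_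
  filter_upwards [hn] with ω hω
  exact Finset.single_le_sum (f := fun i => |g i|) (fun i _ => abs_nonneg _)
    (Finset.mem_range.mpr (Nat.lt_succ_iff.mpr hω))

namespace IsUrnProcess

variable {n : ℕ} {p : ℝ} {U : ℕ → Ω → ℕ} {hU : ∀ i, StronglyMeasurable (U i)}

lemma ae_le (h : IsUrnProcess μ n p U hU) (k : ℕ) : ∀ᵐ ω ∂μ, U k ω ≤ n := by
  induction k with
  | zero => filter_upwards [h.1] with ω hω using hω.le
  | succ k ih => filter_upwards [ih, h.2.1 k] with ω h1 h2 using h2.trans h1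

lemma integral_succ [IsProbabilityMeasure μ] (h : IsUrnProcess μ n p U hU) (k : ℕ) (g : ℕ → ℝ) :
    ∫ ω, g (U (k + 1) ω) ∂μ
      = ∫ ω, ∑ j ∈ Finset.range (U k ω + 1), g (U k ω - j) * binomialProb (U k ω) p j ∂μ := by
  set D : ℕ → Ω → ℝ := fun j =>
    Set.indicator {ω | U k ω - U (k + 1) ω = j} (fun _ => (1 : ℝ)) with hD
  have hDint (j : ℕ) : Integrable (D j) μ := by
    refine (integrable_const (1 : ℝ)).indicator ?_
    exact ((hU k).measurable.sub (hU (k + 1)).measurable) (measurableSet_singleton j)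
  have hgmem (j : ℕ) := memLp_comp_of_ae_le (hU k).measurable (h.ae_le k) (fun i => g (i - j))
  have hGD (j : ℕ) : Integrable ((fun ω => g (U k ω - j)) * D j) μ := by
    refine (hDint j).bdd_mul (c := ∑ i ∈ Finset.range (n + 1), |g (i - j)|)
      (hgmem j 1).aestronglyMeasurable ?_
    filter_upwards [h.ae_le k] with ω hω
    exact Finset.single_le_sum (f := fun i => |g (i - j)|) (fun i _ => abs_nonneg _)
      (Finset.mem_range.mpr (Nat.lt_succ_iff.mpr hω))
  have hcond (j : ℕ) : ∫ ω, ((fun ω => g (U k ω - j)) * D j) ω ∂μ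
      = ∫ ω, g (U k ω - j) * binomialProb (U k ω) p j ∂μ := by
    rw [← integral_condExp ((Filtration.natural U hU).le k)]
    refine integral_congr_ae ?_
    have hsm : StronglyMeasurable[Filtration.natural U hU k] fun ω => g (U k ω - j) :=
      ((measurable_of_countable fun i : ℕ => g (i - j)).comp
        (Filtration.stronglyAdapted_natural hU k).measurable).stronglyMeasurable
    filter_upwards [condExp_mul_of_stronglyMeasurable_left hsm (hGD j) (hDint j), h.2.2 k j]
      with ω h1 h2
    rw [h1, Pi.mul_apply, h2]
  calc ∫ ω, g (U (k + 1) ω) ∂μ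
      = ∫ ω, ∑ j ∈ Finset.range (n + 1), ((fun ω => g (U k ω - j)) * D j) ω ∂μ := by
        refine integral_congr_ae ?_
        filter_upwards [h.ae_le k, h.2.1 k] with ω h1 h2
        rw [Finset.sum_eq_single (U k ω - U (k + 1) ω)]
        · simp [hD, Nat.sub_sub_self h2]
        · intro j _ hj
          simp [hD, hj.symm]
        · intro hj
          exact absurd (Finset.mem_range.mpr (by omega)) hj
    _ = ∑ j ∈ Finset.range (n + 1), ∫ ω, g (U k ω - j) * binomialProb (U k ω) p j ∂μ := by
        rw [integral_finsetSum _ fun j _ => hGD j]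
        exact Finset.sum_congr rfl fun j _ => hcond j
    _ = _ := by
        rw [← integral_finsetSum _ fun j _ => (memLp_one_iff_integrable.mp <|
          memLp_comp_of_ae_le (hU k).measurable (h.ae_le k)
            (fun i => g (i - j) * binomialProb i p j) 1)]
        refine integral_congr_ae ?_
        filter_upwards [h.ae_le k] with ω h1
        exact sum_range_mul_binomialProb h1 p fun j => g (U k ω - j)

lemma integral_eq [IsProbabilityMeasure μ] (h : IsUrnProcess μ n p U hU) (k : ℕ) :
    ∫ ω, (U k ω : ℝ) ∂μ = n * (1 - p) ^ k := by
  induction k with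
  | zero =>
    have h0 : (fun ω => (U 0 ω : ℝ)) =ᵐ[μ] fun _ => (n : ℝ) := by
      filter_upwards [h.1] with ω hω
      rw [hω]
    simp [integral_congr_ae h0]
  | succ k ih =>
    rw [h.integral_succ k fun i => (i : ℝ)]
    simp only [sum_sub_mul_binomialProb]
    rw [integral_mul_const, ih]
    ring

lemma integral_mul_pred_eq [IsProbabilityMeasure μ] (h : IsUrnProcess μ n p U hU) (k : ℕ) :
    ∫ ω, (U k ω : ℝ) * ((U k ω : ℝ) - 1) ∂μ = n * ((n : ℝ) - 1) * (1 - p) ^ (2 * k) := by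
  induction k with
  | zero =>
    have h0 : (fun ω => (U 0 ω : ℝ) * ((U 0 ω : ℝ) - 1)) =ᵐ[μ]
        fun _ => (n : ℝ) * ((n : ℝ) - 1) := by
      filter_upwards [h.1] with ω hω
      rw [hω]
    simp [integral_congr_ae h0]
  | succ k ih =>
    rw [h.integral_succ k fun i => (i : ℝ) * ((i : ℝ) - 1)]
    simp only [sum_sub_mul_pred_mul_binomialProb]
    rw [integral_mul_const, ih]
    ring

lemma variance_eq [IsProbabilityMeasure μ] (h : IsUrnProcess μ n p U hU) (k : ℕ) :
    variance (fun ω => (U k ω : ℝ)) μ = n * (1 - p) ^ k * (1 - (1 - p) ^ k) := by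
  have hmem (g : ℕ → ℝ) := memLp_comp_of_ae_le (hU k).measurable (h.ae_le k) g
  have hsq : ∫ ω, ((fun ω => (U k ω : ℝ)) ^ 2) ω ∂μ
      = n * ((n : ℝ) - 1) * (1 - p) ^ (2 * k) + n * (1 - p) ^ k := by
    rw [← h.integral_mul_pred_eq k, ← h.integral_eq k, ← integral_add
      (memLp_one_iff_integrable.mp (hmem (fun i => (i : ℝ) * ((i : ℝ) - 1)) 1))
      (memLp_one_iff_integrable.mp (hmem (fun i => (i : ℝ)) 1))]
    congr 1 with ω
    simp only [Pi.pow_apply]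
    ring
  rw [variance_eq_sub (hmem (fun i => (i : ℝ)) 2), hsq, h.integral_eq k]
  ring

lemma variance_normalized_eq [IsProbabilityMeasure μ] (h : IsUrnProcess μ n p U hU)
    (hn : n ≠ 0) (hp : p ≠ 1) (k : ℕ) :
    variance (fun ω => (U k ω : ℝ) / (Real.sqrt n * (1 - p) ^ k) - Real.sqrt n) μ
      = ((1 - p) ^ k)⁻¹ - 1 := by
  have hm : Measurable fun ω => (U k ω : ℝ) :=
    (measurable_of_countable fun i : ℕ => (i : ℝ)).comp (hU k).measurable
  rw [variance_sub_const (hm.div_const _).aestronglyMeasurable]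
  simp only [div_eq_mul_inv]
  rw [variance_mul_const, h.variance_eq k, inv_pow, mul_pow, Real.sq_sqrt (Nat.cast_nonneg n)]
  have hn' : (n : ℝ) ≠ 0 := Nat.cast_ne_zero.mpr hn
  have hp' : (1 - p) ^ k ≠ 0 := pow_ne_zero k (sub_ne_zero.mpr hp.symm)
  field_simp

end IsUrnProcess

end Urn

lemma inv_one_sub_le_exp {p : ℝ} (hp0 : 0 ≤ p) (hp : p ≤ 1 / 2) :
    (1 - p)⁻¹ ≤ Real.exp (p + p ^ 2) := by
  have h1 : 0 < 1 - p := by linarith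
  have h2 := Real.quadratic_le_exp_of_nonneg (x := p + p ^ 2) (by positivity)
  refine le_trans ?_ h2
  rw [inv_le_iff_one_le_mul₀ h1]
  have : 0 ≤ p ^ 2 * (1 - 2 * p) := mul_nonneg (sq_nonneg p) (by linarith)
  nlinarith [pow_nonneg hp0 3, pow_nonneg hp0 4, mul_nonneg (pow_nonneg hp0 3) h1.le]

lemma abs_inv_one_sub_pow_sub_exp_le {p : ℝ} (hp0 : 0 ≤ p) (hp : p ≤ 1 / 2) (k : ℕ) :
    |((1 - p) ^ k)⁻¹ - Real.exp (k * p)| ≤ Real.exp (2 * (k * p)) * (k * p ^ 2) := by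
  have h1 : 0 < 1 - p := by linarith
  have hlow : Real.exp (k * p) ≤ ((1 - p) ^ k)⁻¹ := by
    rw [Real.exp_nat_mul, ← inv_pow]
    refine pow_le_pow_left₀ (Real.exp_pos p).le ?_ k
    rw [le_inv_comm₀ (Real.exp_pos p) h1, ← Real.exp_neg]
    exact Real.one_sub_le_exp_neg p
  have hup : ((1 - p) ^ k)⁻¹ ≤ Real.exp (k * (p + p ^ 2)) := by
    rw [Real.exp_nat_mul, ← inv_pow]
    exact pow_le_pow_left₀ (inv_nonneg.mpr h1.le) (inv_one_sub_le_exp hp0 hp) k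
  rw [abs_of_nonneg (sub_nonneg.mpr hlow)]
  have htan : Real.exp (k * (p + p ^ 2)) * (1 - k * p ^ 2) ≤ Real.exp (k * p) := by
    calc Real.exp (k * (p + p ^ 2)) * (1 - k * p ^ 2)
        ≤ Real.exp (k * (p + p ^ 2)) * Real.exp (-(k * p ^ 2)) := by
          gcongr
          exact Real.one_sub_le_exp_neg _
      _ = Real.exp (k * p) := by
          rw [← Real.exp_add]
          ring_nf
  have hexp : Real.exp (k * (p + p ^ 2)) ≤ Real.exp (2 * (k * p)) := by
    refine Real.exp_le_exp.mpr ?_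
    nlinarith [mul_nonneg (Nat.cast_nonneg (α := ℝ) k) (mul_nonneg hp0 h1.le)]
  have := mul_le_mul_of_nonneg_right hexp
    (mul_nonneg (Nat.cast_nonneg (α := ℝ) k) (sq_nonneg p))
  linarith

/-- Let `c > 0`.  For the urn process with parameters `n` and `p = c/n`, the
variance of `T k = U k / (√n (1-c/n)^k) - √n` satisfies: there is a constant
`C > 0` (depending only on `c`) such that for all integers `n > 2c` and all
`0 ≤ k ≤ n`, `|Var(T k) - (e^{ck/n} - 1)| ≤ C / n`. -/
theorem urn_variance_approx (c : ℝ) (hc : 0 < c) :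
    ∃ C : ℝ, 0 < C ∧
      ∀ (Ω : Type) [MeasurableSpace Ω] (μ : Measure Ω) [IsProbabilityMeasure μ]
        (n : ℕ), 2 * c < (n : ℝ) →
        ∀ (U : ℕ → Ω → ℕ) (hU : ∀ i, StronglyMeasurable (U i)),
          IsUrnProcess μ n (c / n) U hU →
          ∀ k : ℕ, k ≤ n →
            |variance
                (fun ω => (U k ω : ℝ) / (Real.sqrt n * (1 - c / n) ^ k) - Real.sqrt n) μ
              - (Real.exp (c * k / n) - 1)| ≤ C / n := by
  refine ⟨Real.exp (2 * c) * c ^ 2, by positivity, ?_⟩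
  intro Ω _ μ _ n hn U hU h k hk
  have hn0 : (0 : ℝ) < n := by linarith
  have hp : c / n ≤ 1 / 2 := by
    rw [div_le_iff₀ hn0]
    linarith
  have hkn : (k : ℝ) ≤ n := Nat.cast_le.mpr hk
  rw [h.variance_normalized_eq (Nat.cast_pos.mp hn0).ne' (by linarith) k, sub_sub_sub_cancel_right,
    show c * k / n = k * (c / n) by ring]
  refine (abs_inv_one_sub_pow_sub_exp_le (by positivity) hp k).trans ?_
  have hkc : k * (c / n) ≤ c := by
    rw [mul_div_assoc', div_le_iff₀ hn0]
    nlinarith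
  calc Real.exp (2 * (k * (c / n))) * (k * (c / n) ^ 2)
      ≤ Real.exp (2 * c) * (n * (c / n) ^ 2) := by gcongr
    _ = Real.exp (2 * c) * c ^ 2 / n := by
        field_simp
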